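/- Let X be a set and R : X × X → X × X a map. Suppose that for every n ≥ 2 the maps T_i^{(n)} = R_{i,i+n-1} ∘ ⋯ ∘ R_{i,i+1} pairwise commute and satisfy T_1^{(n)} ∘ T_2^{(n)} ∘ ⋯ ∘ T_n^{(n)} = Id. Then R is a reversible Yang–Baxter map, i.e. R_{12} ∘ R_{13} ∘ R_{23} = R_{23} ∘ R_{13} ∘ R_{12} on X³ and R_{21} ∘ R = Id. -/

import Mathlib

/-- The map `R_{ij} : Xⁿ → Xⁿ` acting as `R` on the `i`-th and `j`-th coordinates:
it replaces the `i`-th coordinate `x i` by `f (x i, x j)` and the `j`-th coordinate `x j`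
by `g (x i, x j)`, where `R (x, y) = (f (x, y), g (x, y))`, leaving the others fixed. -/
def Rij {X : Type*} (R : X × X → X × X) {n : ℕ} (i j : Fin n) (x : Fin n → X) : Fin n → X :=
  fun k => if k = i then (R (x i, x j)).1 else if k = j then (R (x i, x j)).2 else x k

/-- The transfer map `T_i^{(n)} = R_{i,i+n-1} ∘ R_{i,i+n-2} ∘ ⋯ ∘ R_{i,i+1}`,
with indices taken modulo `n`; the rightmost map `R_{i,i+1}` is applied first. -/
def transfer {X : Type*} (R : X × X → X × X) {n : ℕ} (i : Fin n) :
    (Fin n → X) → (Fin n → X) :=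
  fun x => (List.range (n - 1)).foldl
    (fun y k => Rij R i (i + ⟨(k + 1) % n, Nat.mod_lt _ i.pos⟩) y) x

/-- If `R₂₁ ∘ R = Id`, then `R_{ij}` is a left inverse of `R_{ji}`. -/
theorem Rij_comp_Rij_swap {X : Type*} {R : X × X → X × X}
    (hR : ∀ p : X × X, Prod.swap (R (Prod.swap (R p))) = p) {n : ℕ} {i j : Fin n} (hij : i ≠ j) :
    Rij R i j ∘ Rij R j i = id := by
  funext x
  have h : R ((R (x j, x i)).2, (R (x j, x i)).1) = (x i, x j) := by
    simpa [Prod.swap] using congrArg Prod.swap (hR (x j, x i))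
  funext k
  by_cases hi : k = i
  · simp [Rij, hij, hi, h]
  · by_cases hj : k = j
    · simp [Rij, hij, hij.symm, hj, h]
    · simp [Rij, hi, hj]

/-- The transfer maps for `n = 2`. -/
theorem transfer_two {X : Type*} (R : X × X → X × X) :
    transfer R (0 : Fin 2) = Rij R 0 1 ∧ transfer R (1 : Fin 2) = Rij R 1 0 :=
  ⟨rfl, rfl⟩

/-- The first two transfer maps for `n = 3`. -/
theorem transfer_three {X : Type*} (R : X × X → X × X) :
    transfer R (0 : Fin 3) = Rij R 0 2 ∘ Rij R 0 1 ∧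
      transfer R (1 : Fin 3) = Rij R 1 0 ∘ Rij R 1 2 :=
  ⟨rfl, rfl⟩

/-- If for every `n ≥ 2` the transfer maps `T_i^{(n)}` pairwise commute and satisfy
`T_1^{(n)} ∘ ⋯ ∘ T_n^{(n)} = Id`, then `R` is a reversible Yang–Baxter map:
`R₁₂ ∘ R₁₃ ∘ R₂₃ = R₂₃ ∘ R₁₃ ∘ R₁₂` on `X³` and `R₂₁ ∘ R = Id`. -/
theorem reversible_yang_baxter_of_transfer_properties {X : Type*} (R : X × X → X × X)
    (hcomm : ∀ n : ℕ, 2 ≤ n → ∀ i j : Fin n,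
      transfer R i ∘ transfer R j = transfer R j ∘ transfer R i)
    (hprod : ∀ n : ℕ, 2 ≤ n →
      (List.finRange n).foldr (fun i F => transfer R i ∘ F) id = id) :
    ((Rij R (0 : Fin 3) 1) ∘ (Rij R (0 : Fin 3) 2) ∘ (Rij R (1 : Fin 3) 2) =
       (Rij R (1 : Fin 3) 2) ∘ (Rij R (0 : Fin 3) 2) ∘ (Rij R (0 : Fin 3) 1)) ∧
    (∀ p : X × X, Prod.swap (R (Prod.swap (R p))) = p) := by
  have hrev : ∀ p : X × X, Prod.swap (R (Prod.swap (R p))) = p := by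
    rintro ⟨a, b⟩
    have h : Rij R (1 : Fin 2) 0 ∘ Rij R 0 1 = id := by
      rw [← (transfer_two R).1, ← (transfer_two R).2, hcomm 2 le_rfl]
      simpa [List.finRange_succ] using hprod 2 le_rfl
    have hab := congrFun h ![a, b]
    have h0 := congrFun hab 0
    have h1 := congrFun hab 1
    simp only [Rij, Function.comp_apply] at h0 h1
    exact Prod.ext (by simpa [Prod.swap] using h0) (by simpa [Prod.swap] using h1)
  refine ⟨?_, hrev⟩
  have h01 : Rij R (0 : Fin 3) 1 ∘ Rij R 1 0 = id := Rij_comp_Rij_swap hrev (by decide)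
  have hT := hcomm 3 (by norm_num) 0 1
  rw [(transfer_three R).1, (transfer_three R).2] at hT
  have hT' : Rij R (0 : Fin 3) 2 ∘ Rij R 1 2 =
      Rij R 1 0 ∘ Rij R 1 2 ∘ Rij R 0 2 ∘ Rij R 0 1 := by
    calc Rij R (0 : Fin 3) 2 ∘ Rij R 1 2
        = Rij R 0 2 ∘ (Rij R 0 1 ∘ Rij R 1 0) ∘ Rij R 1 2 := by rw [h01, Function.id_comp]
      _ = _ := hT
  rw [hT', ← Function.comp_assoc, h01, Function.id_comp]
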